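/- arXiv:2209.14986 — 2 statements merged into one kernel-verified Lean document; each statement's English description precedes it below -/
import Mathlib

section
/- Let M → N be a homomorphism of abelian groups, P₀ = M ⊕ ℤ^X with a surjection h : P₀ → N extending M → N, W₀ = ker(h), and 0 → W₁ → Q₁ → W₀ → 0 exact with Q₁ free over ℤ. For any abelian group T, consider the complex K : T⊗_ℤW₁ → T⊗_ℤQ₁ → T⊗_ℤ(P₀/M) (where P₀/M ≅ ℤ^X and the right map is induced by Q₁ → W₀ → P₀ → P₀/M). Then H₂(K) ≅ Tor₁^ℤ(T, ker(M → N)). -/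
open CategoryTheory

/-- The first `Tor` group over `ℤ` of two abelian groups. -/
noncomputable abbrev Tor1Z (A B : Type) [AddCommGroup A] [AddCommGroup B] : ModuleCat ℤ :=
  ((Tor (ModuleCat ℤ) 1).obj (ModuleCat.of ℤ A)).obj (ModuleCat.of ℤ B)

namespace CategoryTheory.ShortComplex

open Limits ZeroObject

universe v u
variable {C : Type u} [Category.{v} C] [Abelian C]

/-- The objects of the two-term complex `S.X₁ ⟶ S.X₂`, in degrees `1` and `0`. -/
noncomputable def twoTermX (S : ShortComplex C) : ℕ → C
  | 0 => S.X₂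
  | 1 => S.X₁
  | _ + 2 => 0

/-- The differentials of the two-term complex `S.X₁ ⟶ S.X₂`. -/
noncomputable def twoTermD (S : ShortComplex C) : ∀ n, S.twoTermX (n + 1) ⟶ S.twoTermX n
  | 0 => S.f
  | _ + 1 => 0

/-- The two-term chain complex `S.X₁ ⟶ S.X₂`, in degrees `1` and `0`. -/
noncomputable def twoTermComplex (S : ShortComplex C) : ChainComplex C ℕ :=
  ChainComplex.of S.twoTermX S.twoTermD fun _ ↦ zero_comp

lemma twoTermComplex_d_one_zero (S : ShortComplex C) : S.twoTermComplex.d 1 0 = S.f :=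
  ChainComplex.of_d S.twoTermX S.twoTermD 0

lemma isZero_twoTermComplex_X (S : ShortComplex C) (n : ℕ) :
    IsZero (S.twoTermComplex.X (n + 2)) :=
  isZero_zero C

lemma ShortExact.twoTermComplex_exactAt_succ {S : ShortComplex C} (hS : S.ShortExact) (n : ℕ) :
    S.twoTermComplex.ExactAt (n + 1) := by
  cases n with
  | zero =>
    rw [HomologicalComplex.exactAt_iff' _ 2 1 0 (by simp) (by simp)]
    have := hS.mono_f
    refine (ShortComplex.exact_iff_mono _ (isZero_twoTermComplex_X S 0 |>.eq_of_src _ _)).2 ?_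
    change Mono (S.twoTermComplex.d 1 0)
    rwa [twoTermComplex_d_one_zero]
  | succ n => exact ShortComplex.exact_of_isZero_X₂ _ (isZero_twoTermComplex_X S n)

/-- A short exact sequence whose first two terms are projective is a projective resolution of its
third term. -/
noncomputable def ShortExact.projectiveResolution {S : ShortComplex C} (hS : S.ShortExact)
    [Projective S.X₁] [Projective S.X₂] : ProjectiveResolution S.X₃ where
  complex := S.twoTermComplex
  projective
    | 0 => inferInstanceAs (Projective S.X₂)
    | 1 => inferInstanceAs (Projective S.X₁)
    | n + 2 => (isZero_twoTermComplex_X S n).projective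
  π := (ChainComplex.toSingle₀Equiv _ _).symm ⟨S.g, by
    rw [twoTermComplex_d_one_zero]
    exact S.zero⟩
  quasiIso := ⟨fun n ↦ by
    cases n with
    | zero =>
      rw [ChainComplex.quasiIsoAt₀_iff, ShortComplex.quasiIso_iff_of_zeros' _ rfl rfl rfl]
      refine (ShortComplex.exact_and_epi_g_iff_of_iso ?_).2 ⟨hS.exact, hS.epi_g⟩
      exact ShortComplex.isoMk (Iso.refl _) (Iso.refl _) (Iso.refl _)
        (by
          simp only [Iso.refl_hom]
          erw [Category.id_comp, Category.comp_id]
          exact (twoTermComplex_d_one_zero S).symm)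
        (by
          simp only [Iso.refl_hom]
          erw [Category.id_comp, Category.comp_id]
          exact (ChainComplex.toSingle₀Equiv_symm_apply_f_zero (C := S.twoTermComplex) S.g _).symm)
    | succ n =>
      rw [quasiIsoAt_iff_exactAt' (hL := ChainComplex.exactAt_succ_single_obj S.X₃ n)]
      exact hS.twoTermComplex_exactAt_succ n⟩

/-- The first left derived functor at the third term of a short exact sequence whose first two
terms are projective. -/
noncomputable def ShortExact.leftDerivedOneIso {S : ShortComplex C} (hS : S.ShortExact)
    [Projective S.X₁] [Projective S.X₂] [HasProjectiveResolutions C] {D : Type*} [Category* D] [Abelian D] (F : C ⥤ D)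
    [F.Additive] : (F.leftDerived 1).obj S.X₃ ≅ kernel (F.map S.f) :=
  let K := (F.mapHomologicalComplex (ComplexShape.down ℕ)).obj S.twoTermComplex
  hS.projectiveResolution.isoLeftDerivedObj F 1 ≪≫
    (K.isoHomologyπ 2 1 (by simp)
      ((F.map_isZero (isZero_twoTermComplex_X S 0)).eq_of_src _ _)).symm ≪≫
    IsLimit.conePointUniqueUpToIso (K.cyclesIsKernel 1 0 (by simp)) (kernelIsKernel (K.d 1 0)) ≪≫
    kernelIsoOfEq (congrArg F.map (twoTermComplex_d_one_zero S))

end CategoryTheory.ShortComplex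

namespace CategoryTheory.Functor

universe v u
variable {C : Type u} [Category.{v} C] [Abelian C] [HasProjectiveResolutions C]
  {D : Type*} [Category* D] [Abelian D]

instance leftDerived_additive (F : C ⥤ D) [F.Additive] (n : ℕ) : (F.leftDerived n).Additive where
  map_add {X Y f g} := by
    let P := projectiveResolution X
    let Q := projectiveResolution Y
    rw [F.leftDerived_map_eq n f (P := P) (Q := Q) _ (ProjectiveResolution.lift_commutes f P Q),
      F.leftDerived_map_eq n g (P := P) (Q := Q) _ (ProjectiveResolution.lift_commutes g P Q),
      F.leftDerived_map_eq n (f + g) (P := P) (Q := Q)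
        (ProjectiveResolution.lift f P Q + ProjectiveResolution.lift g P Q)
        (by simp [Functor.map_add])]
    simp only [Functor.map_add]
    rw [Preadditive.add_comp, Preadditive.comp_add]

end CategoryTheory.Functor

/-- A quotient of an injective abelian group is injective. -/
lemma Module.Injective.of_surjective_int {E E' : Type} [AddCommGroup E] [AddCommGroup E']
    [Module ℤ E] [Module ℤ E'] [Module.Injective ℤ E] (π : E →ₗ[ℤ] E') (hπ : Function.Surjective π) :
    Module.Injective ℤ E' := by
  obtain rfl := Subsingleton.elim ‹Module ℤ E'› (AddCommGroup.toIntModule E')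
  have hdiv (n : ℤ) (hn : n ≠ 0) (e : E') : ∃ x, n • x = e := by
    obtain ⟨a, rfl⟩ := hπ e
    obtain ⟨h, hh⟩ := Module.Injective.extension_property ℤ E ℤ ℤ (LinearMap.lsmul ℤ ℤ n)
      (fun _ _ hxy ↦ mul_left_cancel₀ hn hxy) (LinearMap.toSpanSingleton ℤ E a)
    refine ⟨π (h 1), ?_⟩
    rw [← map_zsmul, ← map_zsmul]
    simpa using congrArg π (LinearMap.congr_fun hh 1)
  choose! d hd using hdiv
  let _ : DivisibleBy E' ℤ :=
    { div e n := if n = 0 then 0 else d n e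
      div_zero _ := if_pos rfl
      div_cancel {n} e hn := by simpa [hn] using hd n hn e }
  exact (Module.Baer.of_divisible E').injective

lemma ModuleCat.hasProjectiveDimensionLT_two_int (Z : ModuleCat.{0} ℤ) :
    HasProjectiveDimensionLT Z 2 := by
  refine hasProjectiveDimensionLT_of_enoughInjectives.{0} Z 2 fun Y ↦ ⟨fun a b ↦ ?_⟩
  let p := (EnoughInjectives.presentation Y).some
  have hS : (ShortComplex.mk _ _ (Limits.cokernel.condition p.f)).ShortExact :=
    { exact := ShortComplex.exact_cokernel p.f }
  have : Injective (Limits.cokernel p.f) := by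
    have : Module.Injective ℤ p.J :=
      Module.injective_module_of_injective_object ℤ p.J (inj := p.injective)
    have : Module.Injective ℤ (Limits.cokernel p.f : ModuleCat ℤ) :=
      Module.Injective.of_surjective_int (E := p.J) (Limits.cokernel.π p.f).hom
        ((ModuleCat.epi_iff_surjective (Limits.cokernel.π p.f)).1 inferInstance)
    exact Module.injective_object_of_injective_module ℤ _ (inj := this)
  have h0 (e : Abelian.Ext Z Y 2) : e = 0 := by
    obtain ⟨x, rfl⟩ := Abelian.Ext.covariant_sequence_exact₁ Z hS e
      (Abelian.Ext.eq_zero_of_injective _) (n₀ := 1) rfl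
    rw [Abelian.Ext.eq_zero_of_injective x, Abelian.Ext.zero_comp]
  rw [h0 a, h0 b]

/-- A subgroup of a projective abelian group is projective. -/
lemma Module.Projective.of_injective_int {A P : Type} [AddCommGroup A] [AddCommGroup P]
    [Module.Projective ℤ P] (i : A →ₗ[ℤ] P) (hi : Function.Injective i) :
    Module.Projective ℤ A := by
  have : Mono (ModuleCat.ofHom i) := (ModuleCat.mono_iff_injective _).2 hi
  have hS : (ShortComplex.mk _ _ (Limits.cokernel.condition (ModuleCat.ofHom i))).ShortExact :=
    { exact := ShortComplex.exact_cokernel _ }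
  have := (hS.hasProjectiveDimensionLT_X₃_iff 0
    ((ModuleCat.of ℤ P).projective_of_categoryTheory_projective)).1
    (ModuleCat.hasProjectiveDimensionLT_two_int _)
  exact (_root_.IsProjective.iff_projective (R := ℤ) A).2 (projective_iff_hasProjectiveDimensionLT_one.2 this)

/-- A retract whose complement factors through a projective object induces an isomorphism on higher
left derived functors. -/
noncomputable def CategoryTheory.Functor.leftDerivedSuccIsoOfSplitting {C D : Type*} [Category* C]
    [Category* D] [Abelian C] [Abelian D] [HasProjectiveResolutions C] (F : C ⥤ D) [F.Additive]
    (n : ℕ) {S : ShortComplex C} (s : S.Splitting) [Projective S.X₃] :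
    (F.leftDerived (n + 1)).obj S.X₂ ≅ (F.leftDerived (n + 1)).obj S.X₁ where
  hom := (F.leftDerived (n + 1)).map s.r
  inv := (F.leftDerived (n + 1)).map S.f
  hom_inv_id := by
    have h := congrArg (F.leftDerived (n + 1)).map s.id
    rwa [Functor.map_add, Functor.map_comp, Functor.map_comp,
      (F.isZero_leftDerived_obj_projective_succ n S.X₃).eq_of_tgt
        ((F.leftDerived (n + 1)).map S.g) 0, Limits.zero_comp, add_zero, Functor.map_id] at h
  inv_hom_id := by rw [← Functor.map_comp, s.f_r, Functor.map_id]

/-- `Tor₁(T, -)` computed from a two-term projective resolution. -/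
lemma Tor1Z.nonempty_linearEquiv {T W Q A : Type} [AddCommGroup T] [AddCommGroup W]
    [AddCommGroup Q] [AddCommGroup A] [Module.Projective ℤ Q] (j : W →ₗ[ℤ] Q) (p : Q →ₗ[ℤ] A)
    (hj : Function.Injective j) (hp : Function.Surjective p)
    (hexact : LinearMap.ker p = LinearMap.range j) :
    Nonempty (LinearMap.ker (LinearMap.lTensor T j) ≃ₗ[ℤ] Tor1Z T A) := by
  let S : ShortComplex (ModuleCat ℤ) := .mk (ModuleCat.ofHom j) (ModuleCat.ofHom p) <| by
    ext x
    exact hexact.ge ⟨x, rfl⟩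
  have hS : S.ShortExact :=
    { exact := (ShortComplex.moduleCat_exact_iff_range_eq_ker S).2 hexact.symm
      mono_f := (ModuleCat.mono_iff_injective _).2 hj
      epi_g := (ModuleCat.epi_iff_surjective _).2 hp }
  have : Module.Projective ℤ W := .of_injective_int j hj
  have : Projective S.X₁ := (ModuleCat.of ℤ W).projective_of_categoryTheory_projective
  have : Projective S.X₂ := (ModuleCat.of ℤ Q).projective_of_categoryTheory_projective
  let F := (MonoidalCategory.tensoringLeft (ModuleCat ℤ)).obj (ModuleCat.of ℤ T)
  exact ⟨(hS.leftDerivedOneIso F ≪≫ ModuleCat.kernelIsoKer (F.map S.f)).symm.toLinearEquiv⟩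

/-- For `h : M × F → N` with `F` projective, `Tor₁(T, -)` of `ker h` is that of the kernel of the
restriction of `h` to `M`, since the latter is a direct summand with projective complement. -/
lemma Tor1Z.nonempty_iso_ker {M N F : Type} [AddCommGroup M] [AddCommGroup N] [AddCommGroup F]
    [Module.Projective ℤ F] (T : Type) [AddCommGroup T] (f : M →ₗ[ℤ] N) (h : (M × F) →ₗ[ℤ] N)
    (hhf : ∀ m : M, h (m, 0) = f m) :
    Nonempty (Tor1Z T (LinearMap.ker h) ≅ Tor1Z T (LinearMap.ker f)) := by
  let q : LinearMap.ker h →ₗ[ℤ] F := LinearMap.snd ℤ M F ∘ₗ (LinearMap.ker h).subtype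
  have : Module.Projective ℤ (LinearMap.range q) :=
    .of_injective_int (LinearMap.range q).subtype Subtype.val_injective
  let i : LinearMap.ker f →ₗ[ℤ] LinearMap.ker h :=
    (LinearMap.inl ℤ M F ∘ₗ (LinearMap.ker f).subtype).codRestrict _ fun m ↦ by
      simp [hhf]
  obtain ⟨s, hs⟩ := Module.projective_lifting_property q.rangeRestrict LinearMap.id
    q.surjective_rangeRestrict
  let e : LinearMap.ker h →ₗ[ℤ] LinearMap.ker h := LinearMap.id - s ∘ₗ q.rangeRestrict
  have he (w) : (e w : M × F).2 = 0 := by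
    have := congrArg Subtype.val (LinearMap.congr_fun hs (q.rangeRestrict w))
    simp only [LinearMap.comp_apply, LinearMap.id_apply] at this
    exact sub_eq_zero.2 this.symm
  let r : LinearMap.ker h →ₗ[ℤ] LinearMap.ker f :=
    (LinearMap.fst ℤ M F ∘ₗ (LinearMap.ker h).subtype ∘ₗ e).codRestrict _ fun w ↦ by
      rw [LinearMap.mem_ker, ← hhf]
      exact (congrArg h (Prod.ext rfl (he w).symm : ((e w : M × F).1, 0) = (e w : M × F))).trans (e w).2
  have hqi (m) : q.rangeRestrict (i m) = 0 := Subtype.ext rfl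
  let S : ShortComplex (ModuleCat ℤ) :=
    .mk (ModuleCat.ofHom i) (ModuleCat.ofHom q.rangeRestrict) (ModuleCat.hom_ext <|
      LinearMap.ext hqi)
  have : Projective S.X₃ :=
    (ModuleCat.of ℤ (LinearMap.range q)).projective_of_categoryTheory_projective
  let σ : S.Splitting :=
    { r := ModuleCat.ofHom r
      s := ModuleCat.ofHom s
      f_r := ModuleCat.hom_ext <| LinearMap.ext fun m ↦ Subtype.ext <| by
        change ((i m - s (q.rangeRestrict (i m)) : LinearMap.ker h) : M × F).1 = m
        rw [hqi, map_zero, sub_zero]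
        rfl
      s_g := ModuleCat.hom_ext hs
      id := ModuleCat.hom_ext <| LinearMap.ext fun w ↦ by
        change i (r w) + s (q.rangeRestrict w) = w
        have : i (r w) = e w := Subtype.ext (Prod.ext rfl (he w).symm)
        rw [this]
        exact sub_add_cancel _ _ }
  exact ⟨((MonoidalCategory.tensoringLeft (ModuleCat ℤ)).obj
    (ModuleCat.of ℤ T)).leftDerivedSuccIsoOfSplitting 0 σ⟩

/-- with `f : M → N` a homomorphism of abelian groups, `P₀ = M ⊕ ℤ^X` with a
surjection `h : P₀ → N` extending `f`, `W₀ = ker h`, `0 → W₁ →^j Q₁ →^p W₀ → 0` exact with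
`Q₁` free, and `T` an abelian group, consider the complex
`K : T⊗W₁ → T⊗Q₁ → T⊗ℤ^X` (in degrees 2,1,0), where the left map is `T ⊗ j` and the right
map is induced by `Q₁ → W₀ → P₀ → P₀/M ≅ ℤ^X`.  Then
`H₂(K) = ker(T ⊗ j) ≅ Tor₁(T, ker f)`. -/
theorem stmt4 (M N X T W₁ Q₁ : Type) [AddCommGroup M] [AddCommGroup N] [AddCommGroup T]
    [AddCommGroup W₁] [AddCommGroup Q₁]
    (f : M →ₗ[ℤ] N)
    (h : (M × (X →₀ ℤ)) →ₗ[ℤ] N)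
    (hhf : ∀ m : M, h (m, 0) = f m)
    (hh : Function.Surjective h)
    (j : W₁ →ₗ[ℤ] Q₁) (p : Q₁ →ₗ[ℤ] ↥(LinearMap.ker h))
    (hj : Function.Injective j) (hp : Function.Surjective p)
    (hexact : LinearMap.ker p = LinearMap.range j)
    (hfree : Module.Free ℤ Q₁)
    -- the degree `1 → 0` differential `d₁ : Q₁ → P₀/M ≅ ℤ^X`
    (d₁ : Q₁ →ₗ[ℤ] (X →₀ ℤ))
    (hd₁ : ∀ x : Q₁, d₁ x = ((p x : M × (X →₀ ℤ))).2) :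
    Nonempty ((LinearMap.ker (LinearMap.lTensor T j)) ≃ₗ[ℤ]
      Tor1Z T ↥(LinearMap.ker f)) := by
  obtain ⟨e⟩ := Tor1Z.nonempty_linearEquiv (T := T) j p hj hp hexact
  obtain ⟨e'⟩ := Tor1Z.nonempty_iso_ker T f h hhf
  exact ⟨e.trans e'.toLinearEquiv⟩
end

section
/- In the same setting, there is a short exact sequence 0 → T ⊗_ℤ ker(M → N) → H₁(K) → Tor₁^ℤ(T, N/im(M → N)) → 0. -/
open CategoryTheory TensorProduct

open CategoryTheory.Limits HomologicalComplex in
/-- A short exact sequence whose first two terms are projective gives a projective resolution of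
length one of its third term. -/
noncomputable def CategoryTheory.ShortComplex.ShortExact.projectiveResolution_s6
    {C : Type*} [Category* C] [Abelian C] {S : ShortComplex C} (hS : S.ShortExact)
    [Projective S.X₁] [Projective S.X₂] : ProjectiveResolution S.X₃ where
  complex := double S.f (ComplexShape.down_mk 1 0 rfl)
  projective n := by
    match n with
    | 0 => exact Projective.of_iso (doubleXIso₁ S.f _ one_ne_zero).symm inferInstance
    | 1 => exact Projective.of_iso (doubleXIso₀ S.f _).symm inferInstance
    | n + 2 =>
      exact Projective.of_iso
        (isZero_double_X S.f (ComplexShape.down_mk 1 0 rfl) (n + 2)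
          (by simp) (by simp)).isoZero.symm inferInstance
  π := (ChainComplex.toSingle₀Equiv _ _).symm
    ⟨(doubleXIso₁ S.f _ one_ne_zero).hom ≫ S.g, by simp [double_d]⟩
  quasiIso := ⟨fun n ↦ by
    have := hS.mono_f
    have := hS.epi_g
    cases n with
    | zero =>
      rw [ChainComplex.quasiIsoAt₀_iff, ShortComplex.quasiIso_iff_of_zeros' _
        (double_d_eq_zero₀ S.f (ComplexShape.down_mk 1 0 rfl) _ _ (by simp)) rfl rfl]
      refine (ShortComplex.exact_and_epi_g_iff_of_iso ?_).2 ⟨hS.exact, hS.epi_g⟩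
      refine ShortComplex.isoMk (doubleXIso₀ S.f (ComplexShape.down_mk 1 0 rfl))
        (doubleXIso₁ S.f (ComplexShape.down_mk 1 0 rfl) one_ne_zero) (Iso.refl _) ?_ ?_
      · change (doubleXIso₀ S.f (ComplexShape.down_mk 1 0 rfl)).hom ≫ S.f =
          (double S.f (ComplexShape.down_mk 1 0 rfl)).d 1 0 ≫
            (doubleXIso₁ S.f (ComplexShape.down_mk 1 0 rfl) one_ne_zero).hom
        simp [double_d]
      · simp only [shortComplexFunctor'_map_τ₂, ChainComplex.toSingle₀Equiv_symm_apply_f_zero]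
        exact (Category.comp_id _).symm
    | succ n =>
      rw [quasiIsoAt_iff_exactAt' (hL := ChainComplex.exactAt_succ_single_obj ..),
        exactAt_iff' _ (n + 2) (n + 1) n (by simp) (by simp)]
      cases n with
      | zero =>
        rw [ShortComplex.exact_iff_mono _
          (double_d_eq_zero₀ S.f (ComplexShape.down_mk 1 0 rfl) _ _ (by simp))]
        change Mono ((double S.f (ComplexShape.down_mk 1 0 rfl)).d 1 0)
        rw [double_d S.f _ one_ne_zero]
        infer_instance
      | succ n =>
        exact ShortComplex.exact_of_isZero_X₂ _
          (isZero_double_X S.f (ComplexShape.down_mk 1 0 rfl) _ (by simp) (by simp))⟩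

open CategoryTheory.Limits HomologicalComplex in
/-- The first left derived functor, computed from a short exact sequence whose first two terms
are projective. -/
theorem CategoryTheory.ShortComplex.ShortExact.exists_leftDerived_one_exact
    {C D : Type*} [Category* C] [Abelian C] [HasProjectiveResolutions C]
    [Category* D] [Abelian D] (F : C ⥤ D) [F.Additive] {S : ShortComplex C} (hS : S.ShortExact)
    [Projective S.X₁] [Projective S.X₂] :
    ∃ (ι : (F.leftDerived 1).obj S.X₃ ⟶ F.obj S.X₁) (w : ι ≫ F.map S.f = 0),
      Mono ι ∧ (ShortComplex.mk ι (F.map S.f) w).Exact := by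
  let K := (F.mapHomologicalComplex _).obj hS.projectiveResolution_s6.complex
  have hd : K.d 2 1 = 0 :=
    (congrArg F.map (double_d_eq_zero₀ S.f (ComplexShape.down_mk 1 0 rfl) 2 1 (by simp))).trans
      (F.map_zero _ _)
  let x₁ : K.X 1 ≅ F.obj S.X₁ := F.mapIso (doubleXIso₀ S.f (ComplexShape.down_mk 1 0 rfl))
  let x₀ : K.X 0 ≅ F.obj S.X₂ :=
    F.mapIso (doubleXIso₁ S.f (ComplexShape.down_mk 1 0 rfl) one_ne_zero)
  have hdOne : K.d 1 0 = x₁.hom ≫ F.map S.f ≫ x₀.inv := by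
    refine (congrArg F.map (double_d S.f (ComplexShape.down_mk 1 0 rfl) one_ne_zero)).trans ?_
    rw [F.map_comp, F.map_comp]
    rfl
  let e := (hS.projectiveResolution_s6.isoLeftDerivedObj F 1) ≪≫
    (K.isoHomologyπ 2 1 (by simp) hd).symm
  have hw : K.iCycles 1 ≫ x₁.hom ≫ F.map S.f = 0 := by
    rw [← cancel_mono x₀.inv]
    simpa [hdOne] using K.iCycles_d 1 0
  refine ⟨e.hom ≫ K.iCycles 1 ≫ x₁.hom, by simp [hw], inferInstance, ?_⟩
  have hK : (ShortComplex.mk (K.iCycles 1) (K.d 1 0) (by simp)).Exact :=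
    ShortComplex.exact_of_f_is_kernel _ (K.cyclesIsKernel 1 0 (by simp))
  refine ShortComplex.exact_of_iso (ShortComplex.isoMk e.symm x₁ x₀ ?_ ?_) hK
  · simp
  · simp [hdOne]

/-- `Tor₁(T, C)` is the kernel of `T ⊗ P₁ → T ⊗ P₀` for a short exact sequence
`0 → P₁ → P₀ → C → 0` with `P₁` and `P₀` projective. -/
theorem ModuleCat.exists_tor_one_exact {R : Type} [CommRing R] (T P₁ P₀ C : Type)
    [AddCommGroup T] [AddCommGroup P₁] [AddCommGroup P₀] [AddCommGroup C]
    [Module R T] [Module R P₁] [Module R P₀] [Module R C]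
    [Module.Projective R P₁] [Module.Projective R P₀] (u : P₁ →ₗ[R] P₀) (v : P₀ →ₗ[R] C)
    (hu : Function.Injective u) (hv : Function.Surjective v) (huv : Function.Exact u v) :
    ∃ ι : ((Tor (ModuleCat R) 1).obj (ModuleCat.of R T)).obj (ModuleCat.of R C) →ₗ[R]
        T ⊗[R] P₁,
      Function.Injective ι ∧ Function.Exact ι (u.lTensor T) := by
  let S : ShortComplex (ModuleCat R) :=
    .mk (ModuleCat.ofHom u) (ModuleCat.ofHom v) (by ext x; exact huv.apply_apply_eq_zero x)
  have hS : S.ShortExact :=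
    { exact := (ShortComplex.ShortExact.moduleCat_exact_iff_function_exact S).2 huv
      mono_f := (ModuleCat.mono_iff_injective _).2 hu
      epi_g := (ModuleCat.epi_iff_surjective _).2 hv }
  have : Projective S.X₁ := (IsProjective.iff_projective P₁).1 inferInstance
  have : Projective S.X₂ := (IsProjective.iff_projective P₀).1 inferInstance
  obtain ⟨ι, w, hι, hex⟩ := hS.exists_leftDerived_one_exact
    ((MonoidalCategory.tensoringLeft (ModuleCat R)).obj (ModuleCat.of R T))
  exact ⟨ι.hom, (ModuleCat.mono_iff_injective _).1 hι,
    (ShortComplex.ShortExact.moduleCat_exact_iff_function_exact _).1 hex⟩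

/-- Over a principal ideal domain, a quotient of a module satisfying Baer's criterion satisfies
Baer's criterion. -/
theorem Module.Baer.of_surjective_of_isPrincipalIdealRing {R Q Q' : Type*} [CommRing R]
    [IsDomain R] [IsPrincipalIdealRing R] [AddCommGroup Q] [AddCommGroup Q'] [Module R Q]
    [Module R Q'] (hQ : Module.Baer R Q) (π : Q →ₗ[R] Q') (hπ : Function.Surjective π) :
    Module.Baer R Q' := by
  intro I g
  obtain ⟨k, hk⟩ := Module.projective_lifting_property π g hπ
  obtain ⟨k', hk'⟩ := hQ I k
  exact ⟨π ∘ₗ k', fun x hx ↦ (congrArg π (hk' x hx)).trans (LinearMap.congr_fun hk ⟨x, hx⟩)⟩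

/-- A linear map whose range lies in that of an injective one factors through it. -/
theorem LinearMap.exists_comp_eq_of_range_le {R A B Y : Type*} [Ring R] [AddCommGroup A]
    [AddCommGroup B] [AddCommGroup Y] [Module R A] [Module R B] [Module R Y]
    {e : B →ₗ[R] Y} (he : Function.Injective e) {i : A →ₗ[R] Y}
    (hi : LinearMap.range i ≤ LinearMap.range e) : ∃ a : A →ₗ[R] B, e ∘ₗ a = i := by
  refine ⟨(LinearEquiv.ofInjective e he).symm.toLinearMap ∘ₗ
    i.codRestrict (LinearMap.range e) (fun x ↦ hi ⟨x, rfl⟩), ?_⟩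
  ext x
  exact congrArg Subtype.val ((LinearEquiv.ofInjective e he).apply_symm_apply _)

open LinearMap in
/-- A module that embeds into a projective module over a principal ideal domain is projective. -/
theorem Module.Projective.of_injective_of_isPrincipalIdealRing {R P S : Type} [CommRing R]
    [IsDomain R] [IsPrincipalIdealRing R] [AddCommGroup P] [AddCommGroup S] [Module R P]
    [Module R S] [Module.Projective R P] (j : S →ₗ[R] P) (hj : Function.Injective j) :
    Module.Projective R S := by
  let π : (S →₀ R) →ₗ[R] S := Finsupp.linearCombination R id
  have hπ : Function.Surjective π := Finsupp.linearCombination_id_surjective R S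
  let I := Injective.under (ModuleCat.of R (S →₀ R))
  let e : (S →₀ R) →ₗ[R] I := (Injective.ι (ModuleCat.of R (S →₀ R))).hom
  have he : Function.Injective e := (ModuleCat.mono_iff_injective _).1 inferInstance
  have hI : Module.Injective R I := Module.injective_module_of_injective_object R I
    (inj := Injective.injective_under _)
  let K : Submodule R I := (ker π).map e
  have hQ : Module.Injective R (I ⧸ K) :=
    ((Module.Baer.of_injective hI).of_surjective_of_isPrincipalIdealRing K.mkQ
      K.mkQ_surjective).injective
  let φ : S →ₗ[R] I ⧸ K := (ker π).mapQ K e (Submodule.le_comap_map _ _) ∘ₗ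
    (π.quotKerEquivOfSurjective hπ).symm.toLinearMap
  have hφ (a : S →₀ R) : φ (π a) = K.mkQ (e a) :=
    congrArg ((ker π).mapQ K e (Submodule.le_comap_map _ _))
      ((π.quotKerEquivOfSurjective hπ).symm_apply_apply (Submodule.Quotient.mk a))
  obtain ⟨ψ, hψ⟩ := hQ.out j hj φ
  obtain ⟨θ, hθ⟩ := Module.projective_lifting_property K.mkQ ψ K.mkQ_surjective
  have hK (a : S →₀ R) : θ (j (π a)) - e a ∈ K := by
    rw [← Submodule.ker_mkQ K, mem_ker, map_sub, ← hφ, ← hψ, ← hθ, LinearMap.comp_apply, sub_self]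
  obtain ⟨σ, hσ⟩ := exists_comp_eq_of_range_le he (i := θ ∘ₗ j) (by
    rintro _ ⟨s, rfl⟩
    obtain ⟨a, rfl⟩ := hπ s
    obtain ⟨b, -, hb⟩ := hK a
    exact ⟨b + a, by rw [map_add, hb, sub_add_cancel, LinearMap.comp_apply]⟩)
  refine Module.Projective.of_split σ π (LinearMap.ext fun s ↦ ?_)
  obtain ⟨a, rfl⟩ := hπ s
  obtain ⟨b, hb, hb'⟩ := hK a
  have hσa : e (σ (π a)) = θ (j (π a)) := LinearMap.congr_fun hσ (π a)
  rw [← hσa, ← map_sub] at hb'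
  rw [he hb', SetLike.mem_coe, mem_ker, map_sub] at hb
  exact sub_eq_zero.1 hb

/-- The sequence of kernels `0 → ker g → ker (v ∘ g) → ker v → 0` attached to a composition with
`g` surjective, for arbitrary models of the three kernels. -/
theorem LinearMap.exists_kernel_comp_shortExact {R A H C Y Z F : Type*} [Ring R]
    [AddCommGroup A] [AddCommGroup H] [AddCommGroup C] [AddCommGroup Y] [AddCommGroup Z]
    [AddCommGroup F] [Module R A] [Module R H] [Module R C] [Module R Y] [Module R Z] [Module R F]
    {i : A →ₗ[R] Y} {e : H →ₗ[R] Y} {ι : C →ₗ[R] Z} {g : Y →ₗ[R] Z} {v : Z →ₗ[R] F}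
    (hi : Function.Injective i) (he : Function.Injective e) (hι : Function.Injective ι)
    (hg : Function.Surjective g) (hig : Function.Exact i g) (hιv : Function.Exact ι v)
    (hev : Function.Exact e (v ∘ₗ g)) :
    ∃ (a : A →ₗ[R] H) (b : H →ₗ[R] C), Function.Injective a ∧ Function.Surjective b ∧
      LinearMap.ker b = LinearMap.range a := by
  obtain ⟨a, ha⟩ := LinearMap.exists_comp_eq_of_range_le he (i := i) (by
    rintro _ ⟨x, rfl⟩
    exact (hev _).1 (by simp [hig.apply_apply_eq_zero]))
  obtain ⟨b, hb⟩ := LinearMap.exists_comp_eq_of_range_le hι (i := g ∘ₗ e) (by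
    rintro _ ⟨x, rfl⟩
    exact (hιv _).1 (hev.apply_apply_eq_zero x))
  replace ha (x : A) : e (a x) = i x := LinearMap.congr_fun ha x
  replace hb (x : H) : ι (b x) = g (e x) := LinearMap.congr_fun hb x
  refine ⟨a, b, fun x y hxy ↦ hi (by rw [← ha, ← ha, hxy]), fun c ↦ ?_, ?_⟩
  · obtain ⟨y, hy⟩ := hg (ι c)
    obtain ⟨x, rfl⟩ := (hev y).1 (by simp [hy, hιv.apply_apply_eq_zero])
    exact ⟨x, hι ((hb x).trans hy)⟩
  · ext x
    rw [LinearMap.mem_ker, ← map_eq_zero_iff ι hι, hb]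
    constructor
    · intro hx
      obtain ⟨t, ht⟩ := (hig _).1 hx
      exact ⟨t, he ((ha t).trans ht)⟩
    · rintro ⟨t, rfl⟩
      rw [ha, hig.apply_apply_eq_zero]

/-- If `q` is surjective with kernel `B`, then `ker d / (ker d ∩ B)` is a model of the kernel of
any map `w` with `w ∘ q = d`. -/
theorem LinearMap.exists_exact_of_comp_eq {R V Y F : Type*} [Ring R]
    [AddCommGroup V] [AddCommGroup Y] [AddCommGroup F] [Module R V] [Module R Y] [Module R F]
    {B : Submodule R V} {d : V →ₗ[R] F} {q : V →ₗ[R] Y} {w : Y →ₗ[R] F}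
    (hq : Function.Surjective q) (hB : LinearMap.ker q = B) (hd : w ∘ₗ q = d) :
    ∃ e : (↥(LinearMap.ker d) ⧸ Submodule.comap (LinearMap.ker d).subtype B) →ₗ[R] Y,
      Function.Injective e ∧ Function.Exact e w := by
  subst hB hd
  refine ⟨Submodule.liftQ _ (q ∘ₗ (LinearMap.ker (w ∘ₗ q)).subtype)
    (LinearMap.ker_comp _ _).ge, ?_, fun y ↦ ⟨fun hy ↦ ?_, ?_⟩⟩
  · rw [← LinearMap.ker_eq_bot, Submodule.ker_liftQ_eq_bot']
    exact (LinearMap.ker_comp _ _).symm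
  · obtain ⟨x, rfl⟩ := hq y
    exact ⟨Submodule.Quotient.mk ⟨x, hy⟩, rfl⟩
  · rintro ⟨x, rfl⟩
    obtain ⟨x, rfl⟩ := Submodule.Quotient.mk_surjective _ x
    exact x.2

/-- in the setting of Proposition 1.2, with `K` the complex
`T⊗W₁ → T⊗Q₁ → T⊗ℤ^X` in degrees 2,1,0 and
`H₁(K) = ker(T⊗d₁) / (ker(T⊗d₁) ∩ im(T⊗j))` the middle homology, there is a short exact
sequence `0 → T ⊗ ker f → H₁(K) → Tor₁(T, N/im f) → 0`. -/
theorem stmt6 (M N X T W₁ Q₁ : Type) [AddCommGroup M] [AddCommGroup N] [AddCommGroup T]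
    [AddCommGroup W₁] [AddCommGroup Q₁]
    (f : M →ₗ[ℤ] N)
    (h : (M × (X →₀ ℤ)) →ₗ[ℤ] N)
    (hhf : ∀ m : M, h (m, 0) = f m)
    (hh : Function.Surjective h)
    (j : W₁ →ₗ[ℤ] Q₁) (p : Q₁ →ₗ[ℤ] ↥(LinearMap.ker h))
    (hj : Function.Injective j) (hp : Function.Surjective p)
    (hexact : LinearMap.ker p = LinearMap.range j)
    (hfree : Module.Free ℤ Q₁)
    (d₁ : Q₁ →ₗ[ℤ] (X →₀ ℤ))
    (hd₁ : ∀ x : Q₁, d₁ x = ((p x : M × (X →₀ ℤ))).2) :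
    ∃ (a : (T ⊗[ℤ] ↥(LinearMap.ker f)) →ₗ[ℤ]
          (↥(LinearMap.ker (LinearMap.lTensor T d₁)) ⧸
            Submodule.comap (LinearMap.ker (LinearMap.lTensor T d₁)).subtype
              (LinearMap.range (LinearMap.lTensor T j))))
      (b : (↥(LinearMap.ker (LinearMap.lTensor T d₁)) ⧸
            Submodule.comap (LinearMap.ker (LinearMap.lTensor T d₁)).subtype
              (LinearMap.range (LinearMap.lTensor T j))) →ₗ[ℤ]
          Tor1Z T (N ⧸ LinearMap.range f)),
      Function.Injective a ∧ Function.Surjective b ∧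
        LinearMap.ker b = LinearMap.range a := by
  let v : (X →₀ ℤ) →ₗ[ℤ] N ⧸ LinearMap.range f :=
    (LinearMap.range f).mkQ ∘ₗ h ∘ₗ LinearMap.inr ℤ M (X →₀ ℤ)
  have hv_snd (x : M × (X →₀ ℤ)) : v x.2 = (LinearMap.range f).mkQ (h x) := by
    have hx : h x = f x.1 + h (0, x.2) := by
      rw [← hhf, ← map_add]
      simp
    have hfx : (LinearMap.range f).mkQ (f x.1) = 0 :=
      (Submodule.Quotient.mk_eq_zero _).2 ⟨x.1, rfl⟩
    rw [hx, map_add, hfx, zero_add]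
    rfl
  have hv : Function.Surjective v := by
    intro c
    obtain ⟨n, rfl⟩ := (LinearMap.range f).mkQ_surjective c
    obtain ⟨x, rfl⟩ := hh n
    exact ⟨x.2, hv_snd x⟩
  have : Module.Projective ℤ (LinearMap.ker v) :=
    .of_injective_of_isPrincipalIdealRing (LinearMap.ker v).subtype Subtype.val_injective
  obtain ⟨ι, hι, hιv⟩ := ModuleCat.exists_tor_one_exact T (LinearMap.ker v) (X →₀ ℤ)
    (N ⧸ LinearMap.range f) (LinearMap.ker v).subtype v.toAddMonoidHom.toIntLinearMap
    Subtype.val_injective hv (fun x ↦ ⟨fun hx ↦ ⟨⟨x, hx⟩, rfl⟩, by rintro ⟨y, rfl⟩; exact y.2⟩)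
  let i : LinearMap.ker f →ₗ[ℤ] LinearMap.ker h :=
    ((LinearMap.inl ℤ M (X →₀ ℤ)) ∘ₗ (LinearMap.ker f).subtype).codRestrict _
      (fun m ↦ (hhf m).trans m.2)
  let g : LinearMap.ker h →ₗ[ℤ] LinearMap.ker v :=
    (LinearMap.snd ℤ M (X →₀ ℤ) ∘ₗ (LinearMap.ker h).subtype).codRestrict _
      (fun x ↦ (hv_snd x).trans (by rw [x.2, map_zero]))
  have hi : Function.Injective i := fun m m' hm ↦
    Subtype.ext (congrArg (fun x : LinearMap.ker h ↦ (x : M × (X →₀ ℤ)).1) hm)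
  have hg : Function.Surjective g := by
    rintro ⟨x, hx⟩
    obtain ⟨m, hm⟩ := (Submodule.Quotient.mk_eq_zero _).1 hx
    suffices hmx : h (-m, x) = 0 from ⟨⟨(-m, x), hmx⟩, rfl⟩
    have hmx : ((-m, x) : M × (X →₀ ℤ)) = (0, x) - (m, 0) := by simp
    rw [hmx, map_sub, hhf, hm]
    exact sub_self _
  have hig : Function.Exact i g := by
    intro x
    constructor
    · intro hx
      have hx₂ : (x : M × (X →₀ ℤ)).2 = 0 := congrArg Subtype.val hx
      have hx₁ : (x : M × (X →₀ ℤ)) = ((x : M × (X →₀ ℤ)).1, 0) := Prod.ext rfl hx₂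
      refine ⟨⟨(x : M × (X →₀ ℤ)).1, ?_⟩, Subtype.ext hx₁.symm⟩
      rw [LinearMap.mem_ker, ← hhf, ← hx₁]
      exact x.2
    · rintro ⟨m, rfl⟩
      rfl
  obtain ⟨e, he, hev⟩ := LinearMap.exists_exact_of_comp_eq
    (d := d₁.lTensor T) (q := p.lTensor T)
    (w := (LinearMap.ker v).subtype.lTensor T ∘ₗ g.lTensor T)
    (LinearMap.lTensor_surjective T hp)
    (lTensor_exact T (LinearMap.exact_iff.2 hexact) hp).linearMap_ker_eq
    (by
      rw [← LinearMap.lTensor_comp, ← LinearMap.lTensor_comp]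
      congr 1
      ext1 x
      exact (hd₁ x).symm)
  exact LinearMap.exists_kernel_comp_shortExact
    (LinearMap.lTensor_injective_of_exact_of_flat g hg i hi hig T) he hι
    (LinearMap.lTensor_surjective T hg) (lTensor_exact T hig hg) hιv hev
end
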